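/- (Theorem 1.3 on ℍ³: global weak-type (2,∞) maximal estimate.) For every α > 1/2 there is a constant C > 0 such that for all even Schwartz functions g : ℝ → ℂ, sup_{u>0} u · ( ∫_{{s>0 : S*g(s) > u}} sinh²(s) ds )^{1/2} ≤ C ‖g‖_{H^α}; that is, ‖S*g‖_{L^{2,∞}(ℍ³)} ≤ C ‖g‖_{H^α}. -/

import Mathlib

open MeasureTheory Filter Set ENNReal

noncomputable section

/-- The Schrödinger propagator on `ℍ³` applied to an even Schwartz function `g`
(the spherical Fourier transform of the radial initial data). -/
def Sprop (g : ℝ → ℂ) (t s : ℝ) : ℂ :=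
  ∫ l in Set.Ioi (0 : ℝ),
    ((Real.sin (l * s) / (l * Real.sinh s) : ℝ) : ℂ)
      * Complex.exp (Complex.I * ((t * (l ^ 2 + 1) : ℝ) : ℂ))
      * g l * ((l : ℂ) ^ 2)

/-- The Schrödinger maximal function `S* g (s) = sup_{0<t<1} |S_t g (s)|`. -/
def Sstar (g : ℝ → ℂ) (s : ℝ) : ℝ :=
  ⨆ t : Set.Ioo (0 : ℝ) 1, ‖Sprop g (t : ℝ) s‖

/-- The fractional Sobolev norm `‖g‖_{H^α}` on `ℍ³`. -/
def sobNorm (α : ℝ) (g : ℝ → ℂ) : ℝ :=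
  (∫ l in Set.Ioi (0 : ℝ), (l ^ 2 + 1) ^ α * ‖g l‖ ^ 2 * l ^ 2) ^ ((1 : ℝ) / 2)

/-- The measure `sinh²(s) ds` on the geodesic ball `B_R` (radial coordinates). -/
def ballMeasure (R : ℝ) : Measure ℝ :=
  (volume.restrict (Set.Ioo 0 R)).withDensity (fun s => ENNReal.ofReal (Real.sinh s ^ 2))

end

theorem aux_weight_integrable (α : ℝ) (g : SchwartzMap ℝ ℂ) :
    Integrable (fun l : ℝ => (l ^ 2 + 1) ^ α * ‖g l‖ ^ 2 * l ^ 2) := by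
  obtain ⟨n, hn⟩ := exists_nat_ge α
  obtain ⟨C, hC⟩ : ∃ C : ℝ, ∀ x : ℝ, (1 + ‖x‖) ^ (2 * n + 2) * ‖g x‖ ≤ C := by
    refine ⟨2 ^ (2 * n + 2) * ((Finset.Iic ((2 * n + 2, 0) : ℕ × ℕ)).sup
      (fun m => SchwartzMap.seminorm ℝ m.1 m.2)) g, fun x => ?_⟩
    have := SchwartzMap.one_add_le_sup_seminorm_apply (𝕜 := ℝ) (m := (2 * n + 2, 0))
      (k := 2 * n + 2) (n := 0) le_rfl le_rfl g x
    simpa using this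
  have hg : Integrable (fun l : ℝ => C * ‖g l‖) := (g.integrable.norm).const_mul C
  refine hg.mono' ?_ ?_
  · apply Continuous.aestronglyMeasurable
    have h1 : Continuous (fun l : ℝ => (l ^ 2 + 1) ^ α) := by
      apply Continuous.rpow_const (by fun_prop)
      intro x
      left
      positivity
    have h2 := g.continuous
    fun_prop
  · refine Filter.Eventually.of_forall fun l => ?_
    rw [Real.norm_of_nonneg (by positivity)]
    have h1 : (l ^ 2 + 1) ^ α ≤ (1 + ‖l‖) ^ (2 * n) := by
      calc (l ^ 2 + 1) ^ α ≤ (l ^ 2 + 1) ^ (n : ℝ) :=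
            Real.rpow_le_rpow_of_exponent_le (by nlinarith [sq_nonneg l]) hn
        _ = (l ^ 2 + 1) ^ n := Real.rpow_natCast _ _
        _ ≤ ((1 + ‖l‖) ^ 2) ^ n := by
            gcongr
            rw [Real.norm_eq_abs]
            nlinarith [sq_abs l, abs_nonneg l]
        _ = _ := by rw [pow_mul]
    have h2 : l ^ 2 ≤ (1 + ‖l‖) ^ 2 := by
      rw [Real.norm_eq_abs]
      nlinarith [sq_abs l, abs_nonneg l]
    calc (l ^ 2 + 1) ^ α * ‖g l‖ ^ 2 * l ^ 2
        ≤ (1 + ‖l‖) ^ (2 * n) * ‖g l‖ ^ 2 * (1 + ‖l‖) ^ 2 := by gcongr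
      _ = ((1 + ‖l‖) ^ (2 * n + 2) * ‖g l‖) * ‖g l‖ := by ring
      _ ≤ C * ‖g l‖ := by gcongr; exact hC l

theorem aux_decay_integrable (α : ℝ) (hα : 1 / 2 < α) :
    Integrable (fun l : ℝ => (l ^ 2 + 1) ^ (-α)) := by
  have := integrable_rpow_neg_one_add_norm_sq (E := ℝ) (μ := volume) (r := 2 * α)
    (by simp; linarith)
  refine this.congr (Filter.Eventually.of_forall fun l => ?_)
  simp only [Real.norm_eq_abs, sq_abs]
  rw [add_comm]
  congr 1
  ring

theorem aux_holder (α : ℝ) (hα : 1 / 2 < α) (g : SchwartzMap ℝ ℂ) :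
    ∫ l in Set.Ioi (0 : ℝ), l * ‖g l‖ ≤
      (∫ l in Set.Ioi (0 : ℝ), (l ^ 2 + 1) ^ (-α)) ^ ((1 : ℝ) / 2) * sobNorm α g := by
  have hc : ∀ β : ℝ, Continuous (fun l : ℝ => (l ^ 2 + 1) ^ β) := fun β =>
    Continuous.rpow_const (by fun_prop) (fun x => Or.inl (by positivity))
  have hg := g.continuous
  have hsq : ∀ (β l : ℝ), ((l ^ 2 + 1) ^ (β / 2)) ^ 2 = (l ^ 2 + 1) ^ β := by
    intro β l
    rw [← Real.rpow_natCast, ← Real.rpow_mul (by positivity)]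
    congr 1
    push_cast
    ring
  have e1 : ∀ l : ℝ, ((l ^ 2 + 1) ^ (-α / 2)) ^ 2 = (l ^ 2 + 1) ^ (-α) := hsq (-α)
  have e2 : ∀ l : ℝ, ((l ^ 2 + 1) ^ (α / 2) * ‖g l‖ * l) ^ 2
      = (l ^ 2 + 1) ^ α * ‖g l‖ ^ 2 * l ^ 2 := by
    intro l
    rw [mul_pow, mul_pow, hsq]
  have m1 : MemLp (fun l : ℝ => (l ^ 2 + 1) ^ (-α / 2)) 2 (volume.restrict (Set.Ioi 0)) := by
    rw [memLp_two_iff_integrable_sq (hc _).aestronglyMeasurable]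
    simp only [e1]
    exact (aux_decay_integrable α hα).integrableOn
  have m2 : MemLp (fun l : ℝ => (l ^ 2 + 1) ^ (α / 2) * ‖g l‖ * l) 2
      (volume.restrict (Set.Ioi 0)) := by
    rw [memLp_two_iff_integrable_sq (by
      apply Continuous.aestronglyMeasurable
      have := hc (α / 2)
      fun_prop)]
    simp only [e2]
    exact (aux_weight_integrable α g).integrableOn
  have key := integral_mul_le_Lp_mul_Lq_of_nonneg (μ := volume.restrict (Set.Ioi (0 : ℝ)))
    (p := 2) (q := 2) ⟨by norm_num, by norm_num, by norm_num⟩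
    (f := fun l : ℝ => (l ^ 2 + 1) ^ (-α / 2))
    (g := fun l : ℝ => (l ^ 2 + 1) ^ (α / 2) * ‖g l‖ * l)
    (Filter.Eventually.of_forall fun l => by positivity)
    (by
      filter_upwards [ae_restrict_mem measurableSet_Ioi] with l hl
      have : (0 : ℝ) < l := hl
      positivity)
    (by simpa using m1) (by simpa using m2)
  simp only [Real.rpow_two, e1, e2] at key
  have e3 : ∀ l : ℝ, (l ^ 2 + 1) ^ (-α / 2) * ((l ^ 2 + 1) ^ (α / 2) * ‖g l‖ * l)
      = l * ‖g l‖ := by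
    intro l
    have : (l ^ 2 + 1) ^ (-α / 2) * (l ^ 2 + 1) ^ (α / 2) = 1 := by
      rw [← Real.rpow_add (by positivity)]
      ring_nf
      simp
    linear_combination (‖g l‖ * l) * this
  simp only [e3] at key
  exact key

theorem aux_Sstar (g : SchwartzMap ℝ ℂ) (s : ℝ) (hs : 0 < s) :
    Sstar g s ≤ (∫ l in Set.Ioi (0 : ℝ), l * ‖g l‖) / Real.sinh s := by
  have hsh : 0 < Real.sinh s := Real.sinh_pos_iff.2 hs
  have hint : IntegrableOn (fun l : ℝ => l * ‖g l‖) (Set.Ioi 0) := by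
    have := (g.integrable_pow_mul volume 1).integrableOn (s := Set.Ioi 0)
    refine this.congr ?_
    filter_upwards [ae_restrict_mem measurableSet_Ioi] with l hl
    have : (0 : ℝ) < l := hl
    simp [abs_of_pos this]
  apply Real.iSup_le
  · rintro ⟨t, ht⟩
    rw [← integral_div]
    refine norm_integral_le_of_norm_le (hint.div_const _) ?_
    filter_upwards [ae_restrict_mem measurableSet_Ioi] with l hl
    have hl : (0 : ℝ) < l := hl
    have he : ‖Complex.exp (Complex.I * ((t * (l ^ 2 + 1) : ℝ) : ℂ))‖ = 1 := by
      rw [mul_comm]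
      exact Complex.norm_exp_ofReal_mul_I _
    rw [norm_mul, norm_mul, norm_mul, he, norm_pow, Complex.norm_real, Complex.norm_real,
      norm_div, norm_mul, Real.norm_of_nonneg hl.le, Real.norm_of_nonneg hsh.le]
    have h1 : ‖Real.sin (l * s)‖ ≤ 1 := Real.abs_sin_le_one _
    calc ‖Real.sin (l * s)‖ / (l * Real.sinh s) * 1 * ‖g l‖ * l ^ 2
        ≤ 1 / (l * Real.sinh s) * 1 * ‖g l‖ * l ^ 2 := by gcongr
      _ = l * ‖g l‖ / Real.sinh s := by field_simp
  · apply div_nonneg _ hsh.le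
    apply setIntegral_nonneg measurableSet_Ioi
    intro l hl
    have : (0 : ℝ) < l := hl
    positivity

theorem aux_vol (T : ℝ) (hT : 0 ≤ T) :
    ∫ s in Set.Ioo 0 T, Real.sinh s ^ 2 ≤ Real.sinh T ^ 2 := by
  rw [← integral_Ioc_eq_integral_Ioo, ← intervalIntegral.integral_of_le hT]
  have hd : ∫ s in (0 : ℝ)..T, 2 * Real.sinh s * Real.cosh s = Real.sinh T ^ 2 := by
    rw [intervalIntegral.integral_eq_sub_of_hasDerivAt (f := fun s => Real.sinh s ^ 2)]
    · simp
    · intro x _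
      have h := (Real.hasDerivAt_sinh x).pow 2
      simp only [Nat.cast_ofNat, Nat.add_one_sub_one, pow_one] at h
      exact h
    · apply Continuous.intervalIntegrable
      fun_prop
  rw [← hd]
  apply intervalIntegral.integral_mono_on hT
  · apply Continuous.intervalIntegrable
    fun_prop
  · apply Continuous.intervalIntegrable
    fun_prop
  · intro x hx
    have h1 : 0 ≤ Real.sinh x := Real.sinh_nonneg_iff.2 hx.1
    have h2 := Real.sinh_lt_cosh x
    nlinarith

/-- Theorem 1.3 on `ℍ³`: the global weak-type `(2,∞)` maximal estimate
`‖S*g‖_{L^{2,∞}(ℍ³)} ≤ C ‖g‖_{H^α}` holds for every `α > 1/2`. -/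
theorem schrodinger_maximal_global_weak_L2 (α : ℝ) (hα : 1 / 2 < α) :
    ∃ C : ℝ, 0 < C ∧ ∀ g : SchwartzMap ℝ ℂ, (∀ x, g (-x) = g x) →
      ∀ u : ℝ, 0 < u →
        u * (∫ s in {s : ℝ | 0 < s ∧ u < Sstar ⇑g s}, Real.sinh s ^ 2) ^ ((1 : ℝ) / 2)
          ≤ C * sobNorm α ⇑g := by
  have hD : 0 ≤ ∫ l in Set.Ioi (0 : ℝ), (l ^ 2 + 1) ^ (-α) :=
    setIntegral_nonneg measurableSet_Ioi (fun l _ => by positivity)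
  refine ⟨(∫ l in Set.Ioi (0 : ℝ), (l ^ 2 + 1) ^ (-α)) ^ ((1 : ℝ) / 2) + 1, by positivity, ?_⟩
  intro g _ u hu
  have hS : 0 ≤ sobNorm α g := by
    apply Real.rpow_nonneg
    exact setIntegral_nonneg measurableSet_Ioi (fun l _ => by positivity)
  have hK0 : 0 ≤ ∫ l in Set.Ioi (0 : ℝ), l * ‖g l‖ := by
    apply setIntegral_nonneg measurableSet_Ioi
    intro l hl
    have : (0 : ℝ) < l := hl
    positivity
  have hK := aux_holder α hα g
  have hst := aux_Sstar g
  generalize (∫ l in Set.Ioi (0 : ℝ), l * ‖g l‖) = K at hK0 hK hst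
  have hT : 0 ≤ Real.arsinh (K / u) := Real.arsinh_nonneg_iff.2 (by positivity)
  have hsub : {s : ℝ | 0 < s ∧ u < Sstar ⇑g s} ⊆ Set.Ioo 0 (Real.arsinh (K / u)) := by
    rintro s ⟨hs, hus⟩
    refine ⟨hs, ?_⟩
    have hsh : 0 < Real.sinh s := Real.sinh_pos_iff.2 hs
    rw [← Real.sinh_lt_sinh, Real.sinh_arsinh, lt_div_iff₀ hu]
    have := lt_of_lt_of_le hus (hst s hs)
    rw [lt_div_iff₀ hsh] at this
    linarith
  have hX : ∫ s in {s : ℝ | 0 < s ∧ u < Sstar ⇑g s}, Real.sinh s ^ 2 ≤ (K / u) ^ 2 := by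
    calc _ ≤ ∫ s in Set.Ioo 0 (Real.arsinh (K / u)), Real.sinh s ^ 2 := by
          apply setIntegral_mono_set
          · apply IntegrableOn.mono_set _ Set.Ioo_subset_Icc_self
            apply Continuous.integrableOn_Icc
            fun_prop
          · exact Filter.Eventually.of_forall fun s => sq_nonneg _
          · exact Filter.Eventually.of_forall hsub
      _ ≤ Real.sinh (Real.arsinh (K / u)) ^ 2 := aux_vol _ hT
      _ = _ := by rw [Real.sinh_arsinh]
  calc _ ≤ u * (K / u) := by
        gcongr
        rw [← Real.sqrt_eq_rpow]
        exact Real.sqrt_le_iff.2 ⟨by positivity, hX⟩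
    _ = K := by field_simp
    _ ≤ _ := hK
    _ ≤ _ := by gcongr; linarith
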